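/- arXiv:2203.02962 — 2 statements merged into one kernel-verified Lean document; each statement's English description precedes it below -/
import Mathlib

section
/- Let N, m ≥ 1, let C, C₀ : Fin N → Matrix (Fin m) (Fin m) ℝ with each C₀ Q positive definite and each C Q symmetric, and let w : Fin N → ℝ with w Q > 0 for all Q. Set G = blockDiagonal (fun Q => w Q • C Q) and G₀ = blockDiagonal (fun Q => w Q • C₀ Q) (real matrices of size N·m). Suppose a, b ∈ ℝ satisfy, for every Q and every z ∈ ℝᵐ, a · (zᵀ (C₀ Q) z) ≤ zᵀ (C Q) z ≤ b · (zᵀ (C₀ Q) z). Then for any real m·N × n matrix D, any x ∈ ℝⁿ with D x ≠ 0 and any λ ∈ ℝ with (Dᵀ G D) x = λ (Dᵀ G₀ D) x, one has a ≤ λ ≤ b. -/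
open Matrix

theorem Matrix.dotProduct_blockDiagonal_mulVec {m o R : Type*} [Fintype m] [Fintype o]
    [DecidableEq o] [NonUnitalNonAssocSemiring R] (M : o → Matrix m m R) (y : m × o → R) :
    y ⬝ᵥ (blockDiagonal M) *ᵥ y =
      ∑ k, (fun i => y (i, k)) ⬝ᵥ M k *ᵥ (fun i => y (i, k)) := by
  simp only [dotProduct, mulVec, Fintype.sum_prod_type, blockDiagonal_apply, ite_mul, zero_mul,
    Finset.sum_ite_eq, Finset.mem_univ, if_true]
  exact Finset.sum_comm

theorem Matrix.dotProduct_transpose_mul_mul_mulVec {m n R : Type*} [Fintype m] [Fintype n]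
    [CommSemiring R] (D : Matrix m n R) (M : Matrix m m R) (x : n → R) :
    x ⬝ᵥ (Dᵀ * M * D) *ᵥ x = D *ᵥ x ⬝ᵥ M *ᵥ D *ᵥ x := by
  rw [← mulVec_mulVec, ← mulVec_mulVec, dotProduct_mulVec, vecMul_transpose]

/-- Eigenvalue bounds for the preconditioned system with block-diagonal
(per-quadrature-point) material data: the bounds depend only on the local
generalized eigenvalue bounds of the pairs `(C Q, C₀ Q)`, independently of the
discretisation matrix `D` and the quadrature weights `w`. -/
theorem blockDiagonal_generalized_eigenvalue_bounds
    {N m n : ℕ} (hN : 1 ≤ N) (hm : 1 ≤ m)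
    (C C₀ : Fin N → Matrix (Fin m) (Fin m) ℝ)
    (hC₀ : ∀ Q, (C₀ Q).PosDef) (hC : ∀ Q, (C Q)ᵀ = C Q)
    (w : Fin N → ℝ) (hw : ∀ Q, 0 < w Q)
    (G G₀ : Matrix (Fin m × Fin N) (Fin m × Fin N) ℝ)
    (hG : G = Matrix.blockDiagonal (fun Q => w Q • C Q))
    (hG₀ : G₀ = Matrix.blockDiagonal (fun Q => w Q • C₀ Q))
    (a b : ℝ)
    (hab : ∀ Q, ∀ z : Fin m → ℝ,
      a * (z ⬝ᵥ (C₀ Q).mulVec z) ≤ z ⬝ᵥ (C Q).mulVec z ∧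
      z ⬝ᵥ (C Q).mulVec z ≤ b * (z ⬝ᵥ (C₀ Q).mulVec z))
    (D : Matrix (Fin m × Fin N) (Fin n) ℝ)
    (x : Fin n → ℝ) (hx : D.mulVec x ≠ 0)
    (lam : ℝ)
    (heig : (Dᵀ * G * D).mulVec x = lam • (Dᵀ * G₀ * D).mulVec x) :
    a ≤ lam ∧ lam ≤ b := by
  subst hG hG₀
  set y := D *ᵥ x with hy
  have hray : y ⬝ᵥ blockDiagonal (fun Q => w Q • C Q) *ᵥ y =
      lam * (y ⬝ᵥ blockDiagonal (fun Q => w Q • C₀ Q) *ᵥ y) := by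
    rw [hy, ← dotProduct_transpose_mul_mul_mulVec, ← dotProduct_transpose_mul_mul_mulVec, heig,
      dotProduct_smul, smul_eq_mul]
  simp only [dotProduct_blockDiagonal_mulVec, smul_mulVec, dotProduct_smul, smul_eq_mul] at hray
  have hpos : 0 < ∑ Q, w Q * ((fun i => y (i, Q)) ⬝ᵥ C₀ Q *ᵥ (fun i => y (i, Q))) := by
    obtain ⟨⟨i, Q⟩, hiQ⟩ := Function.ne_iff.mp hx
    refine Finset.sum_pos' (fun R _ => mul_nonneg (hw R).le ?_) ⟨Q, Finset.mem_univ Q, ?_⟩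
    · simpa using (hC₀ R).posSemidef.dotProduct_mulVec_nonneg (fun i => y (i, R))
    · refine mul_pos (hw Q) ?_
      have hne : (fun i => y (i, Q)) ≠ 0 := fun h => hiQ (congrFun h i)
      simpa using (hC₀ Q).dotProduct_mulVec_pos hne
  constructor
  · refine le_of_mul_le_mul_right ?_ hpos
    rw [← hray, Finset.mul_sum]
    refine Finset.sum_le_sum fun Q _ => ?_
    rw [mul_left_comm]
    exact mul_le_mul_of_nonneg_left (hab Q _).1 (hw Q).le
  · refine le_of_mul_le_mul_right ?_ hpos
    rw [← hray, Finset.mul_sum]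
    refine Finset.sum_le_sum fun Q _ => ?_
    rw [mul_left_comm b]
    exact mul_le_mul_of_nonneg_left (hab Q _).2 (hw Q).le
end

section
/- Let D be a real m×n matrix, C₀ a symmetric positive definite real m×m matrix, and C an arbitrary real m×m matrix. Set M = Dᵀ C₀ D and let G be a real n×n matrix satisfying the four Moore–Penrose conditions for M (M G M = M, G M G = G, (M G)ᵀ = M G, (G M)ᵀ = G M). Then for all x, b ∈ ℝⁿ the following are equivalent: (i) G (Dᵀ C D) x = G b; (ii) (D G Dᵀ) C (D x) = D (G b). In other words, the preconditioned displacement-based equation and the Green's-operator (strain-based) equation for the strain D x have exactly the same solutions. -/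
open Matrix

/-- Equivalence of the displacement-based preconditioned scheme and the
strain-based Green's-operator scheme: with `M = Dᵀ C₀ D` and `G` a
Moore–Penrose inverse of `M`, the equations `G (Dᵀ C D) x = G b` and
`(D G Dᵀ) C (D x) = D (G b)` have exactly the same solutions. -/
theorem displacement_strain_equivalence
    {m n : ℕ} (D : Matrix (Fin m) (Fin n) ℝ)
    (C₀ : Matrix (Fin m) (Fin m) ℝ) (hC₀sym : C₀ᵀ = C₀) (hC₀ : C₀.PosDef)
    (C : Matrix (Fin m) (Fin m) ℝ)
    (G : Matrix (Fin n) (Fin n) ℝ)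
    (h1 : (Dᵀ * C₀ * D) * G * (Dᵀ * C₀ * D) = Dᵀ * C₀ * D)
    (h2 : G * (Dᵀ * C₀ * D) * G = G)
    (h3 : ((Dᵀ * C₀ * D) * G)ᵀ = (Dᵀ * C₀ * D) * G)
    (h4 : (G * (Dᵀ * C₀ * D))ᵀ = G * (Dᵀ * C₀ * D)) :
    ∀ (x b : Fin n → ℝ),
      G.mulVec ((Dᵀ * C * D).mulVec x) = G.mulVec b ↔
      (D * G * Dᵀ).mulVec (C.mulVec (D.mulVec x)) = D.mulVec (G.mulVec b) := by
  intro x b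
  have h_strain : (D * G * Dᵀ).mulVec (C.mulVec (D.mulVec x)) =
      D.mulVec (G.mulVec ((Dᵀ * C * D).mulVec x)) := by
    simp only [mulVec_mulVec, Matrix.mul_assoc]
  have h_recover (v : Fin n → ℝ) : (G * Dᵀ * C₀).mulVec (D.mulVec (G.mulVec v)) = G.mulVec v := by
    conv_rhs => rw [← h2]
    simp only [mulVec_mulVec, Matrix.mul_assoc]
  rw [h_strain]
  refine ⟨fun h => congrArg D.mulVec h, fun h => ?_⟩
  rw [← h_recover, h, h_recover]
end
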